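/- For all six points x₁,…,x₆ ∈ ℂ³, the values T_i = t_i(x₁,…,x₆) satisfy the cubic equation (−T₀ + T₁ − T₂ − T₃ + T₄ − T₅)(T₀T₅ − T₁T₄) − T₀T₂T₃ = 0. -/

import Mathlib

/-- The bracket `[abc]`: determinant of the `3×3` matrix with rows `a, b, c`. -/
noncomputable def br (a b c : Fin 3 → ℂ) : ℂ := Matrix.det (Matrix.of ![a, b, c])

/-- `t₀ = [124][135][236]` (points indexed `0,…,5` for the paper's `1,…,6`). -/
noncomputable def t0 (x : Fin 6 → Fin 3 → ℂ) : ℂ :=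
  br (x 0) (x 1) (x 3) * br (x 0) (x 2) (x 4) * br (x 1) (x 2) (x 5)

/-- `t₁ = [123][135][246]` -/
noncomputable def t1 (x : Fin 6 → Fin 3 → ℂ) : ℂ :=
  br (x 0) (x 1) (x 2) * br (x 0) (x 2) (x 4) * br (x 1) (x 3) (x 5)

/-- `t₂ = [123][134][256]` -/
noncomputable def t2 (x : Fin 6 → Fin 3 → ℂ) : ℂ :=
  br (x 0) (x 1) (x 2) * br (x 0) (x 2) (x 3) * br (x 1) (x 4) (x 5)

/-- `t₃ = [123][125][346]` -/
noncomputable def t3 (x : Fin 6 → Fin 3 → ℂ) : ℂ :=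
  br (x 0) (x 1) (x 2) * br (x 0) (x 1) (x 4) * br (x 2) (x 3) (x 5)

/-- `t₄ = [123][124][356]` -/
noncomputable def t4 (x : Fin 6 → Fin 3 → ℂ) : ℂ :=
  br (x 0) (x 1) (x 2) * br (x 0) (x 1) (x 3) * br (x 2) (x 4) (x 5)

/-- `t₅ = [123][123][456]` -/
noncomputable def t5 (x : Fin 6 → Fin 3 → ℂ) : ℂ :=
  br (x 0) (x 1) (x 2) * br (x 0) (x 1) (x 2) * br (x 3) (x 4) (x 5)

/-- `u = [123][123][123][145][246][356]` -/
noncomputable def uInv (x : Fin 6 → Fin 3 → ℂ) : ℂ :=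
  br (x 0) (x 1) (x 2) * br (x 0) (x 1) (x 2) * br (x 0) (x 1) (x 2) *
    br (x 0) (x 3) (x 4) * br (x 1) (x 3) (x 5) * br (x 2) (x 4) (x 5)

theorem br_eq (a b c : Fin 3 → ℂ) :
    br a b c = a 0 * b 1 * c 2 - a 0 * b 2 * c 1 - a 1 * b 0 * c 2 + a 1 * b 2 * c 0 +
      a 2 * b 0 * c 1 - a 2 * b 1 * c 0 := by
  simp [br, Matrix.det_fin_three]

/-- The three-term Plücker relation for brackets sharing the point `e`. -/
theorem br_plucker (a b c d e : Fin 3 → ℂ) :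
    br a b e * br c d e - br a c e * br b d e = -(br a d e * br b c e) := by
  simp only [br_eq]
  ring

/-- The linear form in the cubic relation is itself a bracket monomial. -/
theorem linear_form_eq (x : Fin 6 → Fin 3 → ℂ) :
    -t0 x + t1 x - t2 x - t3 x + t4 x - t5 x =
      -(br (x 0) (x 2) (x 3) * br (x 0) (x 1) (x 4) * br (x 1) (x 2) (x 5)) := by
  simp only [t0, t1, t2, t3, t4, t5, br_eq]
  ring

theorem stmt_15 (x : Fin 6 → Fin 3 → ℂ) :
    (-t0 x + t1 x - t2 x - t3 x + t4 x - t5 x) * (t0 x * t5 x - t1 x * t4 x) -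
      t0 x * t2 x * t3 x = 0 := by
  rw [linear_form_eq]
  simp only [t0, t1, t2, t3, t4, t5]
  linear_combination
    -(br (x 0) (x 2) (x 3) * br (x 0) (x 1) (x 4) * br (x 1) (x 2) (x 5)) *
      (br (x 0) (x 1) (x 2) ^ 2 * br (x 0) (x 1) (x 3) * br (x 0) (x 2) (x 4)) *
      br_plucker (x 1) (x 2) (x 3) (x 4) (x 5)
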